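/- Let (x̄, ȳ, z̄) be a KKT point and let the G-ADMM-M iterates be given. Define Ψ_k := (1/(σρ))‖z_e^k + σ(ρ−1)A*x_e^k‖² + σ(2−ρ)‖A*x_e^k‖² + (1/ρ)‖x̃_e^{k+1}‖²_{Σ̂_{f1}+S} + (1/ρ)‖ỹ_e^k‖²_{Σ̂_{h1}+T} and θ_k := ‖x̃^{k+1} − x^{k+1}‖²_{(1/2)Σ_{f1} − Σ̂_{f1} + (2−ρ)(Σ̂_{f1}+S)} + ‖ỹ^k − y^k‖²_{(1/2)Σ_{h1} − Σ̂_{h1} + (2−ρ)(Σ̂_{h1}+T)}. Then for every k ≥ 0, Ψ_k − Ψ_{k+1} ≥ θ_k + σ(2−ρ)‖A*x^k + B*y^k − c‖². -/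

import Mathlib

open scoped InnerProductSpace

/-- The quadratic form `‖u‖_G² := ⟪u, G u⟫` associated with a linear operator `G`. -/
noncomputable def qf {E : Type*} [NormedAddCommGroup E] [InnerProductSpace ℝ E]
    (G : E →L[ℝ] E) (u : E) : ℝ := ⟪u, G u⟫_ℝ

/-- `v` is a subgradient of the convex function `f` at `x`. -/
def IsSubgrad {E : Type*} [NormedAddCommGroup E] [InnerProductSpace ℝ E]
    (f : E → ℝ) (v x : E) : Prop := ∀ w, f x + ⟪v, w - x⟫_ℝ ≤ f w

theorem IsSubgrad.inner_sub_nonneg {E : Type*} [NormedAddCommGroup E] [InnerProductSpace ℝ E]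
    {g : E → ℝ} {v v' x x' : E} (h : IsSubgrad g v x) (h' : IsSubgrad g v' x') :
    0 ≤ ⟪v - v', x - x'⟫_ℝ := by
  have h₁ := h x'
  have h₂ := h' x
  rw [← neg_sub x x', inner_neg_right] at h₁
  rw [inner_sub_left]
  linarith

theorem qf_neg {E : Type*} [NormedAddCommGroup E] [InnerProductSpace ℝ E]
    (G : E →L[ℝ] E) (u : E) : qf G (-u) = qf G u := by
  simp [qf]

theorem qf_add_smul {E : Type*} [NormedAddCommGroup E] [InnerProductSpace ℝ E]
    {G : E →L[ℝ] E} (hG : ∀ u v : E, ⟪G u, v⟫_ℝ = ⟪u, G v⟫_ℝ) (r : ℝ) (u v : E) :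
    qf G (u + r • v) = qf G u + 2 * r * ⟪G v, u⟫_ℝ + r ^ 2 * qf G v := by
  simp only [qf, map_add, map_smul, inner_add_left, inner_add_right, real_inner_smul_left,
    real_inner_smul_right]
  rw [← hG v u, real_inner_comm (G v) u]
  ring

/-- The gradient at an intermediate point is monotone up to quadratic forms. -/
theorem inner_gradient_sub_ge {E : Type*} [NormedAddCommGroup E] [InnerProductSpace ℝ E]
    [CompleteSpace E] {f : E → ℝ} {L U : E →L[ℝ] E}
    (hL : ∀ u v : E, ⟪L u, v⟫_ℝ = ⟪u, L v⟫_ℝ) (hL0 : ∀ u : E, 0 ≤ ⟪u, L u⟫_ℝ)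
    (hlow : ∀ x x' : E, (1 / 2) * qf L (x - x') ≤ f x - f x' - ⟪x - x', gradient f x'⟫_ℝ)
    (hupp : ∀ x x' : E, f x - f x' - ⟪x - x', gradient f x'⟫_ℝ ≤ (1 / 2) * qf U (x - x'))
    (x t w : E) :
    (1 / 4) * qf L (t - x) - (1 / 2) * qf U (t - x) ≤
      ⟪gradient f t - gradient f w, x - w⟫_ℝ := by
  have h₁ := hupp x t
  have h₂ := hlow w t
  have h₃ := hlow x w
  have h₀ : 0 ≤ qf L ((w - t) + (1 : ℝ) • (w - x)) := hL0 _
  have hp : qf L (t - x) = qf L ((w - x) + (-1 : ℝ) • (w - t)) := by congr 1; module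
  rw [qf_add_smul hL, ← qf_neg L (w - x), neg_sub] at h₀
  rw [qf_add_smul hL, hL, real_inner_comm, ← qf_neg L (w - x), neg_sub] at hp
  have hq : qf U (x - t) = qf U (t - x) := by rw [← qf_neg, neg_sub]
  have e : ⟪gradient f t - gradient f w, x - w⟫_ℝ =
      ⟪x - t, gradient f t⟫_ℝ - ⟪w - t, gradient f t⟫_ℝ - ⟪x - w, gradient f w⟫_ℝ := by
    rw [← inner_sub_left, sub_sub_sub_cancel_right, inner_sub_left,
      real_inner_comm (x - w), real_inner_comm (x - w)]
  linarith

/-- One relaxed, linearized proximal step contracts the distance to a solution. -/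
theorem relaxed_prox_step {E : Type*} [NormedAddCommGroup E] [InnerProductSpace ℝ E]
    [CompleteSpace E] {f g : E → ℝ} {L U S : E →L[ℝ] E}
    (hL : ∀ u v : E, ⟪L u, v⟫_ℝ = ⟪u, L v⟫_ℝ) (hU : ∀ u v : E, ⟪U u, v⟫_ℝ = ⟪u, U v⟫_ℝ)
    (hS : ∀ u v : E, ⟪S u, v⟫_ℝ = ⟪u, S v⟫_ℝ) (hL0 : ∀ u : E, 0 ≤ ⟪u, L u⟫_ℝ)
    (hlow : ∀ x x' : E, (1 / 2) * qf L (x - x') ≤ f x - f x' - ⟪x - x', gradient f x'⟫_ℝ)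
    (hupp : ∀ x x' : E, f x - f x' - ⟪x - x', gradient f x'⟫_ℝ ≤ (1 / 2) * qf U (x - x'))
    {ρ : ℝ} (hρ : 0 < ρ) {x t w p q : E}
    (hx : IsSubgrad g (-gradient f t - (U + S) (x - t) - p) x)
    (hw : IsSubgrad g (-gradient f w - q) w) :
    qf ((1 / 2 : ℝ) • L - U + (2 - ρ) • (U + S)) (t - x) + 2 * ⟪p - q, x - w⟫_ℝ ≤
      (1 / ρ) * qf (U + S) (t - w) - (1 / ρ) * qf (U + S) (t + ρ • (x - t) - w) := by
  have hP : ∀ u v : E, ⟪(U + S) u, v⟫_ℝ = ⟪u, (U + S) v⟫_ℝ := fun u v ↦ by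
    simp [inner_add_left, inner_add_right, hU, hS]
  have hm := hx.inner_sub_nonneg hw
  have hg := inner_gradient_sub_ge hL hL0 hlow hupp x t w
  have e₁ : -gradient f t - (U + S) (x - t) - p - (-gradient f w - q) =
      -(gradient f t - gradient f w) - (U + S) (x - t) - (p - q) := by abel
  have e₂ : ⟪(U + S) (x - t), x - w⟫_ℝ =
      ⟪(U + S) (x - t), t - w⟫_ℝ + qf (U + S) (x - t) := by
    rw [qf, ← hP, ← inner_add_right, add_comm (t - w), sub_add_sub_cancel]
  have e₃ : qf ((1 / 2 : ℝ) • L - U + (2 - ρ) • (U + S)) (t - x) =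
      (1 / 2) * qf L (t - x) - qf U (t - x) + (2 - ρ) * qf (U + S) (x - t) := by
    rw [← qf_neg (U + S) (x - t), neg_sub]
    simp only [qf, add_apply, sub_apply,
      smul_apply, inner_add_right, inner_sub_right, real_inner_smul_right]
  have e₄ : (1 / ρ) * qf (U + S) (t - w) - (1 / ρ) * qf (U + S) (t + ρ • (x - t) - w) =
      -2 * ⟪(U + S) (x - t), t - w⟫_ℝ - ρ * qf (U + S) (x - t) := by
    rw [add_sub_right_comm, qf_add_smul hP]
    field_simp
    ring
  rw [e₁, inner_sub_left, inner_sub_left, inner_neg_left, e₂] at hm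
  rw [e₃, e₄]
  linarith

/-- The identity governing the multiplier part of the Lyapunov function. -/
theorem multiplier_identity {Z : Type*} [NormedAddCommGroup Z] [InnerProductSpace ℝ Z]
    {σ ρ : ℝ} (hσ : 0 < σ) (hρ : 0 < ρ) {a a' b v v' : Z}
    (hv : v' = v + (σ * (ρ - 1)) • a + σ • a' + (σ * ρ) • b) :
    ((1 / (σ * ρ)) * ‖v + (σ * (ρ - 1)) • a‖ ^ 2 + σ * (2 - ρ) * ‖a‖ ^ 2) -
      ((1 / (σ * ρ)) * ‖v' + (σ * (ρ - 1)) • a'‖ ^ 2 + σ * (2 - ρ) * ‖a'‖ ^ 2) =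
    σ * (2 - ρ) * ‖a + b‖ ^ 2 - 2 * ⟪v', a'⟫_ℝ - 2 * ⟪v + σ • (a + b), b⟫_ℝ := by
  subst hv
  simp only [← real_inner_self_eq_norm_sq, inner_add_left, inner_add_right,
    real_inner_smul_left, real_inner_smul_right]
  rw [real_inner_comm v a, real_inner_comm v a', real_inner_comm v b, real_inner_comm a a',
    real_inner_comm a b, real_inner_comm a' b]
  field_simp
  ring

theorem stmt_13 {X Y Z : Type*}
    [NormedAddCommGroup X] [InnerProductSpace ℝ X] [FiniteDimensional ℝ X]
    [NormedAddCommGroup Y] [InnerProductSpace ℝ Y] [FiniteDimensional ℝ Y]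
    [NormedAddCommGroup Z] [InnerProductSpace ℝ Z] [FiniteDimensional ℝ Z]
    (f1 f2 : X → ℝ) (h1 h2 : Y → ℝ)
    (hf1c : ConvexOn ℝ Set.univ f1) (hf1d : Differentiable ℝ f1)
    (hh1c : ConvexOn ℝ Set.univ h1) (hh1d : Differentiable ℝ h1)
    (hf2c : ConvexOn ℝ Set.univ f2) (hh2c : ConvexOn ℝ Set.univ h2)
    (Sf Sfh : X →L[ℝ] X) (Sh Shh : Y →L[ℝ] Y)
    (hSfsa : ∀ u v : X, ⟪Sf u, v⟫_ℝ = ⟪u, Sf v⟫_ℝ)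
    (hSfhsa : ∀ u v : X, ⟪Sfh u, v⟫_ℝ = ⟪u, Sfh v⟫_ℝ)
    (hShsa : ∀ u v : Y, ⟪Sh u, v⟫_ℝ = ⟪u, Sh v⟫_ℝ)
    (hShhsa : ∀ u v : Y, ⟪Shh u, v⟫_ℝ = ⟪u, Shh v⟫_ℝ)
    (hSfpsd : ∀ u : X, 0 ≤ ⟪u, Sf u⟫_ℝ) (hSfhpsd : ∀ u : X, 0 ≤ ⟪u, Sfh u⟫_ℝ)
    (hShpsd : ∀ u : Y, 0 ≤ ⟪u, Sh u⟫_ℝ) (hShhpsd : ∀ u : Y, 0 ≤ ⟪u, Shh u⟫_ℝ)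
    (hfle : ∀ u : X, 0 ≤ ⟪u, (Sfh - Sf) u⟫_ℝ)
    (hhle : ∀ u : Y, 0 ≤ ⟪u, (Shh - Sh) u⟫_ℝ)
    (hflow : ∀ x x' : X,
      (1 / 2) * qf Sf (x - x') ≤ f1 x - f1 x' - ⟪x - x', gradient f1 x'⟫_ℝ)
    (hfupp : ∀ x x' : X,
      f1 x - f1 x' - ⟪x - x', gradient f1 x'⟫_ℝ ≤ (1 / 2) * qf Sfh (x - x'))
    (hhlow : ∀ y y' : Y,
      (1 / 2) * qf Sh (y - y') ≤ h1 y - h1 y' - ⟪y - y', gradient h1 y'⟫_ℝ)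
    (hhupp : ∀ y y' : Y,
      h1 y - h1 y' - ⟪y - y', gradient h1 y'⟫_ℝ ≤ (1 / 2) * qf Shh (y - y'))
    (A : Z →L[ℝ] X) (As : X →L[ℝ] Z) (B : Z →L[ℝ] Y) (Bs : Y →L[ℝ] Z)
    (hA : ∀ (zz : Z) (xx : X), ⟪A zz, xx⟫_ℝ = ⟪zz, As xx⟫_ℝ)
    (hB : ∀ (zz : Z) (yy : Y), ⟪B zz, yy⟫_ℝ = ⟪zz, Bs yy⟫_ℝ)
    (c : Z) (σ ρ : ℝ) (hσ : 0 < σ) (hρ : ρ ∈ Set.Ioo (0 : ℝ) 2)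
    (S : X →L[ℝ] X) (T : Y →L[ℝ] Y)
    (hSsa : ∀ u v : X, ⟪S u, v⟫_ℝ = ⟪u, S v⟫_ℝ)
    (hTsa : ∀ u v : Y, ⟪T u, v⟫_ℝ = ⟪u, T v⟫_ℝ)
    (hSpsd : ∀ u : X, 0 ≤ ⟪u, S u⟫_ℝ) (hTpsd : ∀ u : Y, 0 ≤ ⟪u, T u⟫_ℝ)
    (x xt : ℕ → X) (y yt : ℕ → Y) (z zt : ℕ → Z)
    (hfocx : ∀ k, IsSubgrad f2
      (-gradient f1 (xt k) - (Sfh + S) (x k - xt k) - A (z k)) (x k))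
    (hzdef : ∀ k, z k = zt k + σ • (As (x k) + Bs (yt k) - c))
    (hfocy : ∀ k, IsSubgrad h2
      (-gradient h1 (yt k) - (Shh + T) (y k - yt k) -
        B (z k + σ • (As (x k) + Bs (y k) - c))) (y k))
    (hxt : ∀ k, xt (k + 1) = xt k + ρ • (x k - xt k))
    (hyt : ∀ k, yt (k + 1) = yt k + ρ • (y k - yt k))
    (hzt : ∀ k, zt (k + 1) = zt k + ρ • (z k - zt k))
    (xb : X) (yb : Y) (zb : Z)
    (hkkt1 : IsSubgrad f2 (-gradient f1 xb - A zb) xb)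
    (hkkt2 : IsSubgrad h2 (-gradient h1 yb - B zb) yb)
    (hkkt3 : As xb + Bs yb = c) :
    ∀ k : ℕ,
      ((1 / (σ * ρ)) * ‖(z k - zb) + (σ * (ρ - 1)) • As (x k - xb)‖ ^ 2 +
        σ * (2 - ρ) * ‖As (x k - xb)‖ ^ 2 +
        (1 / ρ) * qf (Sfh + S) (xt (k + 1) - xb) +
        (1 / ρ) * qf (Shh + T) (yt k - yb)) -
      ((1 / (σ * ρ)) * ‖(z (k + 1) - zb) + (σ * (ρ - 1)) • As (x (k + 1) - xb)‖ ^ 2 +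
        σ * (2 - ρ) * ‖As (x (k + 1) - xb)‖ ^ 2 +
        (1 / ρ) * qf (Sfh + S) (xt (k + 2) - xb) +
        (1 / ρ) * qf (Shh + T) (yt (k + 1) - yb)) ≥
      qf ((1 / 2 : ℝ) • Sf - Sfh + (2 - ρ) • (Sfh + S)) (xt (k + 1) - x (k + 1)) +
        qf ((1 / 2 : ℝ) • Sh - Shh + (2 - ρ) • (Shh + T)) (yt k - y k) +
        σ * (2 - ρ) * ‖As (x k) + Bs (y k) - c‖ ^ 2 := by
  intro k
  obtain ⟨hρ0, -⟩ := hρ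
  have hX := relaxed_prox_step hSfsa hSfhsa hSsa hSfpsd hflow hfupp hρ0 (hfocx (k + 1)) hkkt1
  have hY := relaxed_prox_step hShsa hShhsa hTsa hShpsd hhlow hhupp hρ0
    (hfocy k) hkkt2
  rw [← hxt, ← map_sub, hA] at hX
  rw [← hyt, ← map_sub, hB] at hY
  have hres : As (x k) + Bs (y k) - c = As (x k - xb) + Bs (y k - yb) := by
    rw [← hkkt3, map_sub, map_sub]
    abel
  have hz : z (k + 1) - zb = (z k - zb) + (σ * (ρ - 1)) • As (x k - xb) +
      σ • As (x (k + 1) - xb) + (σ * ρ) • Bs (y k - yb) := by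
    have h := hzdef k
    rw [hzdef (k + 1), hzt, hyt, ← hkkt3]
    rw [← hkkt3, ← sub_eq_iff_eq_add] at h
    rw [← h]
    simp only [map_add, map_sub, map_smul]
    module
  have hZ := multiplier_identity hσ hρ0 hz
  rw [hres, add_sub_right_comm] at hY
  rw [hres]
  linarith
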